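/- arXiv:math/0602604 — 2 statements merged into one kernel-verified Lean document; each statement's English description precedes it below -/
import Mathlib

section
/- Let G be a groupoid with exactly 2 objects u ≠ v and exactly 4 morphisms in total (the cardinality of Σ (a b : G), a ⟶ b is 4). Then either both hom-sets u ⟶ v and v ⟶ u are empty, or else each of the four hom-sets u ⟶ u, v ⟶ v, u ⟶ v, v ⟶ u has exactly one element. -/
open CategoryTheory

theorem groupoid_type_4_2_dichotomy {G : Type*} [Groupoid G] [Fintype G]
    [∀ a b : G, Fintype (a ⟶ b)]
    (u v : G) (huv : u ≠ v) (hobj : ∀ x : G, x = u ∨ x = v)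
    (hcard : Fintype.card (Σ (a : G) (b : G), a ⟶ b) = 4) :
    (IsEmpty (u ⟶ v) ∧ IsEmpty (v ⟶ u)) ∨
    (Fintype.card (u ⟶ u) = 1 ∧ Fintype.card (v ⟶ v) = 1 ∧
      Fintype.card (u ⟶ v) = 1 ∧ Fintype.card (v ⟶ u) = 1) := by
  classical
  have huniv : (Finset.univ : Finset G) = {u, v} := by
    ext x
    simpa using hobj x
  simp only [Fintype.card_sigma, huniv, Finset.sum_pair huv] at hcard
  by_cases h : Nonempty (u ⟶ v)
  · right
    obtain ⟨f⟩ := h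
    have h1 : 0 < Fintype.card (u ⟶ u) := Fintype.card_pos_iff.mpr ⟨𝟙 u⟩
    have h2 : 0 < Fintype.card (v ⟶ v) := Fintype.card_pos_iff.mpr ⟨𝟙 v⟩
    have h3 : 0 < Fintype.card (u ⟶ v) := Fintype.card_pos_iff.mpr ⟨f⟩
    have h4 : 0 < Fintype.card (v ⟶ u) := Fintype.card_pos_iff.mpr ⟨Groupoid.inv f⟩
    omega
  · left
    exact ⟨⟨fun f => h ⟨f⟩⟩, ⟨fun f => h ⟨Groupoid.inv f⟩⟩⟩
end

section
/- Let G be a groupoid with exactly 2 objects u ≠ v and exactly 4 morphisms in total, and suppose the hom-set u ⟶ v is empty. Then, after possibly interchanging u and v, exactly one of the following holds: (a) the hom-set u ⟶ u has exactly one element and the automorphism group Aut v is isomorphic to the cyclic group ℤ/3 (i.e., Aut v ≃* Multiplicative (ZMod 3)); or (b) both automorphism groups Aut u and Aut v are isomorphic to ℤ/2 (i.e., Aut u ≃* Multiplicative (ZMod 2) and Aut v ≃* Multiplicative (ZMod 2)). -/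
open CategoryTheory

theorem aut_card_aux {G : Type*} [Groupoid G] (a : G) [Fintype (a ⟶ a)] :
    Nat.card (Aut a) = Fintype.card (a ⟶ a) := by
  rw [← Nat.card_eq_fintype_card]
  exact Nat.card_congr (Groupoid.isoEquivHom a a)

theorem aut_iso_aux {G : Type*} [Groupoid G] (a : G) [Fintype (a ⟶ a)] (p : ℕ)
    (hp : p.Prime) : Nonempty (Aut a ≃* Multiplicative (ZMod p)) ↔ Fintype.card (a ⟶ a) = p := by
  have : Fact p.Prime := ⟨hp⟩
  have h2 : Nat.card (Multiplicative (ZMod p)) = p := by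
    rw [Nat.card_congr Multiplicative.toAdd, Nat.card_zmod]
  rw [← aut_card_aux]
  constructor
  · rintro ⟨e⟩
    rw [Nat.card_congr e.toEquiv, h2]
  · intro h
    exact ⟨mulEquivOfPrimeCardEq h h2⟩

theorem groupoid_type_4_2_group_bundle_cases {G : Type*} [Groupoid G] [Fintype G]
    [∀ a b : G, Fintype (a ⟶ b)]
    (u v : G) (huv : u ≠ v) (hobj : ∀ x : G, x = u ∨ x = v)
    (hcard : Fintype.card (Σ (a : G) (b : G), a ⟶ b) = 4)
    (hempty : IsEmpty (u ⟶ v)) :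
    ∃ u' v' : G, u' ≠ v' ∧ ({u', v'} : Set G) = {u, v} ∧
      Xor'
        (Fintype.card (u' ⟶ u') = 1 ∧ Nonempty (Aut v' ≃* Multiplicative (ZMod 3)))
        (Nonempty (Aut u' ≃* Multiplicative (ZMod 2)) ∧
          Nonempty (Aut v' ≃* Multiplicative (ZMod 2))) := by
  classical
  have hempty' : IsEmpty (v ⟶ u) := ⟨fun f => hempty.false (Groupoid.inv f)⟩
  have huniv : (Finset.univ : Finset G) = {u, v} := by
    ext x; simpa using hobj x
  have h1 : Fintype.card (u ⟶ v) = 0 := Fintype.card_eq_zero_iff.2 hempty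
  have h2 : Fintype.card (v ⟶ u) = 0 := Fintype.card_eq_zero_iff.2 hempty'
  have hsum : Fintype.card (u ⟶ u) + Fintype.card (v ⟶ v) = 4 := by
    simp only [Fintype.card_sigma, huniv, Finset.sum_pair huv, h1, h2] at hcard
    omega
  have hu : 0 < Fintype.card (u ⟶ u) := Fintype.card_pos_iff.2 ⟨𝟙 u⟩
  have hv : 0 < Fintype.card (v ⟶ v) := Fintype.card_pos_iff.2 ⟨𝟙 v⟩
  simp only [aut_iso_aux _ 2 Nat.prime_two, aut_iso_aux _ 3 Nat.prime_three, Xor', Xor]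
  by_cases h : Fintype.card (u ⟶ u) = 3
  · exact ⟨v, u, huv.symm, Set.pair_comm _ _, by omega⟩
  · exact ⟨u, v, huv, rfl, by omega⟩
end
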